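/- arXiv:0801.2887 — 10 statements merged into one kernel-verified Lean document; each statement's English description precedes it below -/
import Mathlib

section
/- For every natural number P and every pair of families of quaternions m_1, …, m_P and n_1, …, n_P, there exist quaternions A, B, C, D such that for all quaternions q, ∑_{p=1}^{P} m_p · q · n_p = A·q + B·q·i + C·q·j + D·q·k. -/
open scoped Quaternion

/-- The imaginary units of the real quaternions. -/
def qi : ℍ[ℝ] := ⟨0, 1, 0, 0⟩
def qj : ℍ[ℝ] := ⟨0, 0, 1, 0⟩
def qk : ℍ[ℝ] := ⟨0, 0, 0, 1⟩

/-- Every quaternion is a real combination of `1`, `qi`, `qj`, `qk`, so right multiplication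
by it is the same combination of right multiplications by the units. -/
theorem mul_mul_eq_units (a q b : ℍ[ℝ]) :
    a * q * b = (a * (b.re : ℍ[ℝ])) * q + (a * (b.imI : ℍ[ℝ])) * q * qi
      + (a * (b.imJ : ℍ[ℝ])) * q * qj + (a * (b.imK : ℍ[ℝ])) * q * qk := by
  ext <;> simp <;> simp [qi, qj, qk] <;> ring

/-- any general linear quaternion function `q ↦ ∑ p, m p * q * n p`
can be written in the canonic form `q ↦ A*q + B*q*i + C*q*j + D*q*k`. -/
theorem stmt_0 (P : ℕ) (m n : Fin P → ℍ[ℝ]) :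
    ∃ A B C D : ℍ[ℝ], ∀ q : ℍ[ℝ],
      ∑ p : Fin P, m p * q * n p = A * q + B * q * qi + C * q * qj + D * q * qk := by
  refine ⟨∑ p, m p * ((n p).re : ℍ[ℝ]), ∑ p, m p * ((n p).imI : ℍ[ℝ]),
    ∑ p, m p * ((n p).imJ : ℍ[ℝ]), ∑ p, m p * ((n p).imK : ℍ[ℝ]), fun q => ?_⟩
  simp only [Finset.sum_mul, ← Finset.sum_add_distrib]
  exact Finset.sum_congr rfl fun p _ => mul_mul_eq_units (m p) q (n p)
end

section
/- For every natural number P and every pair of families of quaternions m_1, …, m_P and n_1, …, n_P, there exist quaternions A', B', C', D' such that for all quaternions q, ∑_{p=1}^{P} m_p · q · n_p = q·A' + i·q·B' + j·q·C' + k·q·D'. -/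
open scoped Quaternion

theorem Quaternion.eq_add_imaginary_units (a : ℍ[ℝ]) :
    a = (a.re : ℍ[ℝ]) + a.imI • qi + a.imJ • qj + a.imK • qk := by
  ext <;> simp <;> simp [qi, qj, qk]

/-- The left coefficient of `a * q * b` splits into real components, which move to the right. -/
theorem Quaternion.mul_mul_eq_canonic (a b q : ℍ[ℝ]) :
    a * q * b = q * (a.re * b) + qi * q * (a.imI * b) + qj * q * (a.imJ * b)
      + qk * q * (a.imK * b) := by
  conv_lhs => rw [eq_add_imaginary_units a]
  simp only [coe_mul_eq_smul, add_mul, smul_mul_assoc, mul_smul_comm]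

/-- any general linear quaternion function `q ↦ ∑ p, m p * q * n p`
can be written in the right-sided canonic form `q ↦ q*A' + i*q*B' + j*q*C' + k*q*D'`. -/
theorem stmt_1 (P : ℕ) (m n : Fin P → ℍ[ℝ]) :
    ∃ A' B' C' D' : ℍ[ℝ], ∀ q : ℍ[ℝ],
      ∑ p : Fin P, m p * q * n p = q * A' + qi * q * B' + qj * q * C' + qk * q * D' := by
  refine ⟨∑ p, (m p).re * n p, ∑ p, (m p).imI * n p, ∑ p, (m p).imJ * n p,
    ∑ p, (m p).imK * n p, fun q => ?_⟩
  simp only [Finset.mul_sum, ← Finset.sum_add_distrib]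
  exact Finset.sum_congr rfl fun p _ => Quaternion.mul_mul_eq_canonic (m p) (n p) q
end

section
/- The coefficients of the canonic form are unique: if A, B, C, D are quaternions such that A·q + B·q·i + C·q·j + D·q·k = 0 for all quaternions q, then A = B = C = D = 0. -/
open scoped Quaternion

theorem re_qi : qi.re = 0 := rfl
theorem imI_qi : qi.imI = 1 := rfl
theorem imJ_qi : qi.imJ = 0 := rfl
theorem imK_qi : qi.imK = 0 := rfl
theorem re_qj : qj.re = 0 := rfl
theorem imI_qj : qj.imI = 0 := rfl
theorem imJ_qj : qj.imJ = 1 := rfl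
theorem imK_qj : qj.imK = 0 := rfl
theorem re_qk : qk.re = 0 := rfl
theorem imI_qk : qk.imI = 0 := rfl
theorem imJ_qk : qk.imJ = 0 := rfl
theorem imK_qk : qk.imK = 1 := rfl

/-- uniqueness of the coefficients of the canonic form. -/
theorem stmt_4 (A B C D : ℍ[ℝ])
    (h : ∀ q : ℍ[ℝ], A * q + B * q * qi + C * q * qj + D * q * qk = 0) :
    A = 0 ∧ B = 0 ∧ C = 0 ∧ D = 0 := by
  have h1 := h 1
  have h2 := h qi
  have h3 := h qj
  have h4 := h qk
  simp only [Quaternion.ext_iff, re_qi, imI_qi, imJ_qi, imK_qi, re_qj, imI_qj,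
    imJ_qj, imK_qj, re_qk, imI_qk, imJ_qk, imK_qk,
    Quaternion.re_add, Quaternion.imI_add,
    Quaternion.imJ_add, Quaternion.imK_add, Quaternion.re_mul, Quaternion.imI_mul,
    Quaternion.imJ_mul, Quaternion.imK_mul, Quaternion.re_zero, Quaternion.imI_zero,
    Quaternion.imJ_zero, Quaternion.imK_zero, Quaternion.re_one, Quaternion.imI_one,
    Quaternion.imJ_one, Quaternion.imK_one] at h1 h2 h3 h4 ⊢
  obtain ⟨_, _, _, _⟩ := h1
  obtain ⟨_, _, _, _⟩ := h2
  obtain ⟨_, _, _, _⟩ := h3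
  obtain ⟨_, _, _, _⟩ := h4
  refine ⟨⟨?_, ?_, ?_, ?_⟩, ⟨?_, ?_, ?_, ?_⟩, ⟨?_, ?_, ?_, ?_⟩, ⟨?_, ?_, ?_, ?_⟩⟩ <;> linarith
end

section
/- The coefficients of the right-sided canonic form are unique: if A', B', C', D' are quaternions such that q·A' + i·q·B' + j·q·C' + k·q·D' = 0 for all quaternions q, then A' = B' = C' = D' = 0. -/
open scoped Quaternion

/-- uniqueness of the coefficients of the right-sided canonic form. -/
theorem stmt_5 (A' B' C' D' : ℍ[ℝ])
    (h : ∀ q : ℍ[ℝ], q * A' + qi * q * B' + qj * q * C' + qk * q * D' = 0) :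
    A' = 0 ∧ B' = 0 ∧ C' = 0 ∧ D' = 0 := by
  have h1 := h 1
  have h2 := h qi
  have h3 := h qj
  have h4 := h qk
  simp only [Quaternion.ext_iff, Quaternion.re_add, Quaternion.imI_add, Quaternion.imJ_add,
    Quaternion.imK_add, Quaternion.re_mul, Quaternion.imI_mul, Quaternion.imJ_mul,
    Quaternion.imK_mul, Quaternion.re_one, Quaternion.imI_one, Quaternion.imJ_one,
    Quaternion.imK_one, Quaternion.re_zero, Quaternion.imI_zero, Quaternion.imJ_zero,
    Quaternion.imK_zero] at h1 h2 h3 h4 ⊢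
  simp only [qi, qj, qk] at h1 h2 h3 h4
  obtain ⟨_, _, _, _⟩ := h1
  obtain ⟨_, _, _, _⟩ := h2
  obtain ⟨_, _, _, _⟩ := h3
  obtain ⟨_, _, _, _⟩ := h4
  refine ⟨⟨?_, ?_, ?_, ?_⟩, ⟨?_, ?_, ?_, ?_⟩, ⟨?_, ?_, ?_, ?_⟩, ⟨?_, ?_, ?_, ?_⟩⟩ <;> linarith
end

section
/- The sixteen ℝ-linear maps from the quaternions to the quaternions of the form q ↦ e_r · q · e_s, where e_r and e_s each range over the standard basis elements 1, i, j, k, are linearly independent over ℝ and span the space of all ℝ-linear endomorphisms of the quaternions; that is, they form an ℝ-basis of the 16-dimensional real vector space of ℝ-linear maps ℍ → ℍ. -/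
open scoped Quaternion

/-- The standard basis `1, i, j, k` of the real quaternions. -/
noncomputable def quatBasis : Fin 4 → ℍ[ℝ] :=
  ![1, ⟨0, 1, 0, 0⟩, ⟨0, 0, 1, 0⟩, ⟨0, 0, 0, 1⟩]

/-- The sixteen ℝ-linear maps `q ↦ e_r * q * e_s`. -/
noncomputable def sandwichMap (rs : Fin 4 × Fin 4) : ℍ[ℝ] →ₗ[ℝ] ℍ[ℝ] :=
  (LinearMap.mulRight ℝ (quatBasis rs.2)).comp (LinearMap.mulLeft ℝ (quatBasis rs.1))

theorem re_quatBasis (r : Fin 4) : (quatBasis r).re = if r = 0 then 1 else 0 := by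
  fin_cases r <;> simp [quatBasis]

theorem imI_quatBasis (r : Fin 4) : (quatBasis r).imI = if r = 1 then 1 else 0 := by
  fin_cases r <;> simp [quatBasis]

theorem imJ_quatBasis (r : Fin 4) : (quatBasis r).imJ = if r = 2 then 1 else 0 := by
  fin_cases r <;> simp [quatBasis]

theorem imK_quatBasis (r : Fin 4) : (quatBasis r).imK = if r = 3 then 1 else 0 := by
  fin_cases r <;> simp [quatBasis]

theorem linearIndependent_sandwichMap : LinearIndependent ℝ sandwichMap := by
  rw [Fintype.linearIndependent_iff]
  intro c hc
  have h (q : ℍ[ℝ]) : ∑ rs, c rs • (quatBasis rs.1 * q * quatBasis rs.2) = 0 := by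
    simpa [sandwichMap] using LinearMap.congr_fun hc q
  have h0 := h (quatBasis 0)
  have h1 := h (quatBasis 1)
  have h2 := h (quatBasis 2)
  have h3 := h (quatBasis 3)
  simp [Fintype.sum_prod_type, Fin.sum_univ_four, Quaternion.ext_iff, re_quatBasis,
    imI_quatBasis, imJ_quatBasis, imK_quatBasis] at h0 h1 h2 h3
  obtain ⟨h00, h01, h02, h03⟩ := h0
  obtain ⟨h10, h11, h12, h13⟩ := h1
  obtain ⟨h20, h21, h22, h23⟩ := h2
  obtain ⟨h30, h31, h32, h33⟩ := h3
  rintro ⟨r, s⟩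
  fin_cases r <;> fin_cases s <;>
    simp only [Fin.mk_one, Fin.reduceFinMk, Fin.zero_eta] <;> linarith

/-- the sixteen maps `q ↦ e_r * q * e_s` are linearly independent over ℝ
and span the space of all ℝ-linear endomorphisms of ℍ, i.e. they form an ℝ-basis of that
16-dimensional space. -/
theorem stmt_6 :
    LinearIndependent ℝ sandwichMap ∧
      Submodule.span ℝ (Set.range sandwichMap) = ⊤ := by
  refine ⟨linearIndependent_sandwichMap,
    linearIndependent_sandwichMap.span_eq_top_of_card_eq_finrank ?_⟩
  simp [Module.finrank_linearMap, Quaternion.finrank_eq_four]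
end

section
/- Every ℝ-linear map f from the quaternions to the quaternions can be written as a sum of at most four double-sided terms: there exist quaternions m_1, m_2, m_3, m_4 and n_1, n_2, n_3, n_4 such that f(q) = ∑_{p=1}^{4} m_p · q · n_p for all quaternions q. -/
namespace Quaternion

/-- The quaternions `1, i, j, k`. -/
def unitBasis : Fin 4 → ℍ[ℝ] :=
  fun a ↦ ⟨![1, 0, 0, 0] a, ![0, 1, 0, 0] a, ![0, 0, 1, 0] a, ![0, 0, 0, 1] a⟩

@[simp] lemma re_unitBasis (a : Fin 4) : (unitBasis a).re = ![1, 0, 0, 0] a := rfl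

@[simp] lemma imI_unitBasis (a : Fin 4) : (unitBasis a).imI = ![0, 1, 0, 0] a := rfl

@[simp] lemma imJ_unitBasis (a : Fin 4) : (unitBasis a).imJ = ![0, 0, 1, 0] a := rfl

@[simp] lemma imK_unitBasis (a : Fin 4) : (unitBasis a).imK = ![0, 0, 0, 1] a := rfl

lemma linearMap_apply_eq_smul_add (f : ℍ[ℝ] →ₗ[ℝ] ℍ[ℝ]) (q : ℍ[ℝ]) :
    f q = q.re • f (unitBasis 0) + q.imI • f (unitBasis 1) + q.imJ • f (unitBasis 2) +
      q.imK • f (unitBasis 3) := by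
  simp only [← map_smul, ← map_add]
  congr 1
  ext <;> simp

/-- The real part as a sum of double-sided products. -/
lemma coe_re_eq_sum_unitBasis (x : ℍ[ℝ]) :
    (x.re : ℍ[ℝ]) = ∑ b, unitBasis b * x * ((1 / 4 : ℝ) • star (unitBasis b)) := by
  ext <;> (simp [Fin.sum_univ_four]; try ring)

lemma linearMap_apply_eq_sum_re (f : ℍ[ℝ] →ₗ[ℝ] ℍ[ℝ]) (q : ℍ[ℝ]) :
    f q = ∑ a, ((q * star (unitBasis a)).re : ℍ[ℝ]) * f (unitBasis a) := by
  rw [linearMap_apply_eq_smul_add f q]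
  simp [Fin.sum_univ_four, coe_mul_eq_smul]

end Quaternion

open Quaternion in
/-- every ℝ-linear map `ℍ → ℍ` is a sum of at most four double-sided terms. -/
theorem stmt_8 (f : ℍ[ℝ] →ₗ[ℝ] ℍ[ℝ]) :
    ∃ m n : Fin 4 → ℍ[ℝ], ∀ q : ℍ[ℝ],
      f q = ∑ p : Fin 4, m p * q * n p := by
  refine ⟨unitBasis, fun b ↦ ∑ a, star (unitBasis a) *
    ((1 / 4 : ℝ) • star (unitBasis b)) * f (unitBasis a), fun q ↦ ?_⟩
  rw [linearMap_apply_eq_sum_re]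
  simp only [coe_re_eq_sum_unitBasis, Finset.sum_mul, Finset.mul_sum]
  rw [Finset.sum_comm]
  simp only [mul_assoc]
end

section
/- For every natural number P and every pair of families of quaternions m_1, …, m_P and n_1, …, n_P, there exist quaternions A_1, A_2, A_3, A_4 and E_1, E_2, E_3, E_4 such that for all quaternions q, ∑_{p=1}^{P} m_p · q · n_p = ∑_{r=1}^{4} A_r · q · E_r; that is, any general linear quaternion function, regardless of the number of terms P, can be expressed as a sum of at most four double-sided terms. -/
open scoped Quaternion

/-- Expanding the right coefficients in a basis, a sum of double-sided terms can be rewritten with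
one term for each basis vector. -/
theorem Module.Basis.exists_sum_mul_mul_eq {ι κ R S : Type*} [CommSemiring R] [Semiring S]
    [Algebra R S] [Fintype ι] [Fintype κ] (b : Module.Basis ι R S) (m n : κ → S) :
    ∃ A : ι → S, ∀ q : S, ∑ p, m p * q * n p = ∑ r, A r * q * b r := by
  refine ⟨fun r => ∑ p, b.repr (n p) r • m p, fun q => ?_⟩
  simp_rw [Finset.sum_mul]
  rw [Finset.sum_comm]
  refine Finset.sum_congr rfl fun p _ => ?_
  conv_lhs => rw [← b.sum_repr (n p)]
  simp_rw [Finset.mul_sum, mul_smul_comm, smul_mul_assoc]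

/-- any general linear quaternion function, regardless of the number of terms
`P`, can be expressed as a sum of at most four double-sided terms. -/
theorem stmt_9 (P : ℕ) (m n : Fin P → ℍ[ℝ]) :
    ∃ A E : Fin 4 → ℍ[ℝ], ∀ q : ℍ[ℝ],
      ∑ p : Fin P, m p * q * n p = ∑ r : Fin 4, A r * q * E r := by
  let b : Module.Basis (Fin 4) ℝ ℍ[ℝ] := QuaternionAlgebra.basisOneIJK _ _ _
  obtain ⟨A, hA⟩ := b.exists_sum_mul_mul_eq m n
  exact ⟨A, b, hA⟩
end

section
/- A general linear quaternion function cannot always be reduced to fewer than four double-sided terms: there exists an ℝ-linear map f from the quaternions to the quaternions such that there do not exist quaternions m_1, m_2, m_3, n_1, n_2, n_3 with f(q) = m_1·q·n_1 + m_2·q·n_2 + m_3·q·n_3 for all quaternions q. -/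
open scoped Quaternion

namespace Quaternion

/-- The imaginary unit `i`. -/
def unitI : ℍ[ℝ] := ⟨0, 1, 0, 0⟩

@[simp]
theorem components_unitI :
    unitI.re = 0 ∧ unitI.imI = 1 ∧ unitI.imJ = 0 ∧ unitI.imK = 0 :=
  ⟨rfl, rfl, rfl, rfl⟩

/-- The imaginary unit `j`. -/
def unitJ : ℍ[ℝ] := ⟨0, 0, 1, 0⟩

@[simp]
theorem components_unitJ :
    unitJ.re = 0 ∧ unitJ.imI = 0 ∧ unitJ.imJ = 1 ∧ unitJ.imK = 0 :=
  ⟨rfl, rfl, rfl, rfl⟩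

/-- The imaginary unit `k`. -/
def unitK : ℍ[ℝ] := ⟨0, 0, 0, 1⟩

@[simp]
theorem components_unitK :
    unitK.re = 0 ∧ unitK.imI = 0 ∧ unitK.imJ = 0 ∧ unitK.imK = 1 :=
  ⟨rfl, rfl, rfl, rfl⟩

/-- The twisted sum `x * f 1 - i * x * f i - j * x * f j - k * x * f k` of a map `f`. -/
noncomputable def twistedSum (f : ℍ[ℝ] → ℍ[ℝ]) (x : ℍ[ℝ]) : ℍ[ℝ] :=
  x * f 1 - unitI * x * f unitI - unitJ * x * f unitJ - unitK * x * f unitK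

theorem twistedSum_add (f g : ℍ[ℝ] → ℍ[ℝ]) (x : ℍ[ℝ]) :
    twistedSum (fun q => f q + g q) x = twistedSum f x + twistedSum g x := by
  simp only [twistedSum, mul_add]
  abel

theorem twistedSum_mul_mul (m n x : ℍ[ℝ]) :
    twistedSum (fun q => m * q * n) x = (4 * (x * m).re) • n := by
  have key (y : ℍ[ℝ]) : y - unitI * y * unitI - unitJ * y * unitJ - unitK * y * unitK =
      ((4 * y.re : ℝ) : ℍ[ℝ]) := by
    ext <;> simp <;> ring
  rw [← coe_mul_eq_smul, ← key (x * m)]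
  simp only [twistedSum, sub_mul, mul_assoc, mul_one]

theorem twistedSum_star (x : ℍ[ℝ]) : twistedSum star x = (-2 : ℝ) • star x := by
  ext <;> simp [twistedSum] <;> ring

theorem exists_ne_zero_re_mul_eq_zero (m : Fin 3 → ℍ[ℝ]) :
    ∃ x : ℍ[ℝ], x ≠ 0 ∧ ∀ a, (x * m a).re = 0 := by
  let g : ℍ[ℝ] →ₗ[ℝ] Fin 3 → ℝ :=
    { toFun := fun x a => (x * m a).re
      map_add' := fun x y => by ext a; simp only [add_mul, re_add, Pi.add_apply]
      map_smul' := fun r x => by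
        ext a; simp only [smul_mul_assoc, re_smul, Pi.smul_apply, RingHom.id_apply] }
  have hg : LinearMap.ker g ≠ ⊥ :=
    LinearMap.ker_ne_bot_of_finrank_lt (by simp [Quaternion.finrank_eq_four])
  obtain ⟨x, hx, hx0⟩ := Submodule.exists_mem_ne_zero_of_ne_bot hg
  exact ⟨x, hx0, fun a => congrFun (LinearMap.mem_ker.mp hx) a⟩

end Quaternion

/-- a general linear quaternion function cannot always be reduced to fewer
than four double-sided terms. -/
theorem stmt_10 :
    ∃ f : ℍ[ℝ] →ₗ[ℝ] ℍ[ℝ],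
      ¬ ∃ m₁ m₂ m₃ n₁ n₂ n₃ : ℍ[ℝ], ∀ q : ℍ[ℝ],
        f q = m₁ * q * n₁ + m₂ * q * n₂ + m₃ * q * n₃ := by
  refine ⟨{ toFun := star, map_add' := star_add, map_smul' := fun r x => by simp }, ?_⟩
  rintro ⟨m₁, m₂, m₃, n₁, n₂, n₃, h⟩
  have hstar : (star : ℍ[ℝ] → ℍ[ℝ]) = fun q => m₁ * q * n₁ + m₂ * q * n₂ + m₃ * q * n₃ := funext h
  obtain ⟨x, hx0, hx⟩ := Quaternion.exists_ne_zero_re_mul_eq_zero ![m₁, m₂, m₃]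
  have h₁ : (x * m₁).re = 0 := hx 0
  have h₂ : (x * m₂).re = 0 := hx 1
  have h₃ : (x * m₃).re = 0 := hx 2
  have hsum := Quaternion.twistedSum_star x
  rw [hstar, Quaternion.twistedSum_add, Quaternion.twistedSum_add, Quaternion.twistedSum_mul_mul,
    Quaternion.twistedSum_mul_mul, Quaternion.twistedSum_mul_mul, h₁, h₂, h₃, ← hstar] at hsum
  simp only [mul_zero, zero_smul, add_zero] at hsum
  exact hx0 (by simpa using hsum.symm)
end

section
/- Meister's proposed form is not a canonic (general) form for linear quaternion functions: there exists an ℝ-linear map f from the quaternions to the quaternions such that there do not exist quaternions A, B, C, D with f(q) = A·q + q·B + C·q·D for all quaternions q. -/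
open scoped Quaternion

/-- Meister's proposed form `f(q) = A q + q B + C q D` is not a general
(canonic) form for ℝ-linear quaternion functions. -/
theorem stmt_11 :
    ∃ f : ℍ[ℝ] →ₗ[ℝ] ℍ[ℝ],
      ¬ ∃ A B C D : ℍ[ℝ], ∀ q : ℍ[ℝ],
        f q = A * q + q * B + C * q * D := by
  -- The witness is `q ↦ i q i + j q j`: in the basis `q ↦ u q v` of the linear maps, with `u`, `v`
  -- among `1, i, j, k`, its purely imaginary block has rank 2, while that of the form is the
  -- product of the imaginary parts of `C` and `D`.
  let I : ℍ[ℝ] := ⟨0, 1, 0, 0⟩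
  let J : ℍ[ℝ] := ⟨0, 0, 1, 0⟩
  refine ⟨LinearMap.mulLeftRight ℝ (I, I) + LinearMap.mulLeftRight ℝ (J, J), ?_⟩
  rintro ⟨A, B, C, D, h⟩
  simp only [LinearMap.add_apply, LinearMap.mulLeftRight_apply, Quaternion.ext_iff,
    Quaternion.re_add, Quaternion.imI_add, Quaternion.imJ_add, Quaternion.imK_add,
    Quaternion.re_mul, Quaternion.imI_mul, Quaternion.imJ_mul, Quaternion.imK_mul] at h
  have h0 := h ⟨1, 0, 0, 0⟩
  have h1 := h ⟨0, 1, 0, 0⟩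
  have h2 := h ⟨0, 0, 1, 0⟩
  have h3 := h ⟨0, 0, 0, 1⟩
  norm_num [I, J] at h0 h1 h2 h3
  obtain ⟨a0, a1, a2, a3⟩ := h0
  obtain ⟨b0, b1, b2, b3⟩ := h1
  obtain ⟨c0, c1, c2, c3⟩ := h2
  obtain ⟨d0, d1, d2, d3⟩ := h3
  have hii : C.imI * D.imI = 1 := by linarith
  have hjj : C.imJ * D.imJ = 1 := by linarith
  have hij : C.imI * D.imJ = 0 := by linarith
  have : (1 : ℝ) = 0 := by
    linear_combination C.imJ * D.imI * hij - hii * C.imJ * D.imJ - hjj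
  norm_num at this
end

section
/- Adding one further double-sided term to Meister's form is still not sufficient to obtain a general form: there exists an ℝ-linear map f from the quaternions to the quaternions such that there do not exist quaternions A, B, C, D, E, F with f(q) = A·q + q·B + C·q·D + E·q·F for all quaternions q. -/
open scoped Quaternion

/-- A sum of two rank-one `3 × 3` matrices is never a nonzero scalar matrix. -/
lemma not_scalar_of_sum_two_rank_one {c₁ c₂ c₃ d₁ d₂ d₃ e₁ e₂ e₃ f₁ f₂ f₃ t : ℝ} (ht : t ≠ 0)
    (h₁₁ : c₁ * d₁ + e₁ * f₁ = t) (h₁₂ : c₁ * d₂ + e₁ * f₂ = 0) (h₁₃ : c₁ * d₃ + e₁ * f₃ = 0)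
    (h₂₁ : c₂ * d₁ + e₂ * f₁ = 0) (h₂₂ : c₂ * d₂ + e₂ * f₂ = t) (h₂₃ : c₂ * d₃ + e₂ * f₃ = 0)
    (h₃₁ : c₃ * d₁ + e₃ * f₁ = 0) (h₃₂ : c₃ * d₂ + e₃ * f₂ = 0)
    (h₃₃ : c₃ * d₃ + e₃ * f₃ = t) : False := by
  have det_eq_zero :
      (c₁ * d₁ + e₁ * f₁) * ((c₂ * d₂ + e₂ * f₂) * (c₃ * d₃ + e₃ * f₃)
          - (c₂ * d₃ + e₂ * f₃) * (c₃ * d₂ + e₃ * f₂))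
        - (c₁ * d₂ + e₁ * f₂) * ((c₂ * d₁ + e₂ * f₁) * (c₃ * d₃ + e₃ * f₃)
          - (c₂ * d₃ + e₂ * f₃) * (c₃ * d₁ + e₃ * f₁))
        + (c₁ * d₃ + e₁ * f₃) * ((c₂ * d₁ + e₂ * f₁) * (c₃ * d₂ + e₃ * f₂)
          - (c₂ * d₂ + e₂ * f₂) * (c₃ * d₁ + e₃ * f₁)) = 0 := by ring
  rw [h₁₁, h₁₂, h₁₃, h₂₁, h₂₂, h₂₃, h₃₁, h₃₂, h₃₃] at det_eq_zero
  simp [ht] at det_eq_zero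

/-- even augmenting Meister's form with a fourth term `E q F` does not
yield a general form for ℝ-linear quaternion functions. -/
theorem stmt_12 :
    ∃ f : ℍ[ℝ] →ₗ[ℝ] ℍ[ℝ],
      ¬ ∃ A B C D E F : ℍ[ℝ], ∀ q : ℍ[ℝ],
        f q = A * q + q * B + C * q * D + E * q * F := by
  -- Conjugation is `-(q + i q i + j q j + k q k) / 2`, with scalar imaginary coefficient block.
  refine ⟨{ toFun := star, map_add' := star_add, map_smul' := fun r q => by simp }, ?_⟩
  rintro ⟨A, B, C, D, E, F, h⟩
  simp only [LinearMap.coe_mk, AddHom.coe_mk, Quaternion.ext_iff, Quaternion.re_star,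
    Quaternion.imI_star, Quaternion.imJ_star, Quaternion.imK_star, Quaternion.re_add,
    Quaternion.imI_add, Quaternion.imJ_add, Quaternion.imK_add, Quaternion.re_mul,
    Quaternion.imI_mul, Quaternion.imJ_mul, Quaternion.imK_mul] at h
  have h1 := h ⟨1, 0, 0, 0⟩
  have hi := h ⟨0, 1, 0, 0⟩
  have hj := h ⟨0, 0, 1, 0⟩
  have hk := h ⟨0, 0, 0, 1⟩
  clear h
  simp only [mul_zero, zero_mul, mul_one, one_mul] at h1 hi hj hk
  obtain ⟨h11, h12, h13, h14⟩ := h1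
  obtain ⟨hi1, hi2, hi3, hi4⟩ := hi
  obtain ⟨hj1, hj2, hj3, hj4⟩ := hj
  obtain ⟨hk1, hk2, hk3, hk4⟩ := hk
  apply not_scalar_of_sum_two_rank_one (t := -1 / 2)
    (c₁ := C.imI) (c₂ := C.imJ) (c₃ := C.imK) (d₁ := D.imI) (d₂ := D.imJ) (d₃ := D.imK)
    (e₁ := E.imI) (e₂ := E.imJ) (e₃ := E.imK) (f₁ := F.imI) (f₂ := F.imJ) (f₃ := F.imK)
    (by norm_num) <;> linarith
end
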